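/- Let (X, Σ, μ) be a complete σ-finite measure space such that μ is not purely atomic, let 𝔹 be a Banach space, and let ℓ be a von Neumann lifting of μ. Then the following are equivalent: (i) there exists an operator L : L∞(μ; 𝔹) → ℒ∞(μ; 𝔹) such that L(π_μ(1_X v̄))(x) = v̄ for every v̄ ∈ 𝔹 and every x ∈ X; L(v) represents v (i.e. L(v)(x) agrees μ-a.e. with any representative of v); L(v + w)(x) = L(v)(x) + L(w)(x) for all v, w ∈ L∞(μ; 𝔹) and all x; L(f · v)(x) = ℓ(f)(x) L(v)(x) for all v ∈ L∞(μ; 𝔹), f ∈ L∞(μ) and all x; and ‖L(v)(x)‖_𝔹 = ℓ(‖v(·)‖_𝔹)(x) for all v ∈ L∞(μ; 𝔹) and all x; (ii) 𝔹 is finite-dimensional. -/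

import Mathlib

open MeasureTheory Set

/-- A von Neumann lifting of a measure `μ`: a Boolean homomorphism `ℓ : Σ → Σ` selecting
a.e.-representatives. -/
structure IsVNLifting {X : Type*} [MeasurableSpace X] (μ : MeasureTheory.Measure X)
    (ℓ : Set X → Set X) : Prop where
  measurableSet : ∀ E : Set X, MeasurableSet E → MeasurableSet (ℓ E)
  map_empty : ℓ (∅ : Set X) = ∅
  map_univ : ℓ (Set.univ : Set X) = Set.univ
  map_inter : ∀ E F : Set X, MeasurableSet E → MeasurableSet F → ℓ (E ∩ F) = ℓ E ∩ ℓ F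
  map_union : ∀ E F : Set X, MeasurableSet E → MeasurableSet F → ℓ (E ∪ F) = ℓ E ∪ ℓ F
  congr_ae : ∀ E F : Set X, MeasurableSet E → MeasurableSet F →
    μ (symmDiff E F) = 0 → ℓ E = ℓ F
  ae_symmDiff : ∀ E : Set X, MeasurableSet E → μ (symmDiff E (ℓ E)) = 0
/-- `A` is an atom of the measure `μ`: a measurable set of positive measure such that every
measurable subset either is null or has null complement in `A`. -/
def IsMeasureAtom {X : Type*} [MeasurableSpace X] (μ : MeasureTheory.Measure X)
    (A : Set X) : Prop :=
  MeasurableSet A ∧ 0 < μ A ∧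
    ∀ B : Set X, MeasurableSet B → B ⊆ A → μ B = 0 ∨ μ (A \ B) = 0
/-- The lifting of functions `L : L∞(μ) → ℒ∞(Σ)` induced by a von Neumann lifting `ℓ`:
it is linear, norm-nonincreasing pointwise, selects representatives, and sends the class
of an indicator `1_E` to `1_{ℓ E}`. -/
def IsLinftyLifting {X : Type*} [MeasurableSpace X] (μ : MeasureTheory.Measure X)
    (ℓ : Set X → Set X) (L : MeasureTheory.Lp ℝ ⊤ μ → X → ℝ) : Prop :=
  (∀ f g : MeasureTheory.Lp ℝ ⊤ μ, L (f + g) = L f + L g) ∧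
  (∀ (c : ℝ) (f : MeasureTheory.Lp ℝ ⊤ μ), L (c • f) = c • L f) ∧
  (∀ f : MeasureTheory.Lp ℝ ⊤ μ, Measurable (L f)) ∧
  (∀ (f : MeasureTheory.Lp ℝ ⊤ μ) (x : X), |L f x| ≤ ‖f‖) ∧
  (∀ f : MeasureTheory.Lp ℝ ⊤ μ, L f =ᵐ[μ] f) ∧
  (∀ E : Set X, MeasurableSet E → ∀ f : MeasureTheory.Lp ℝ ⊤ μ,
    (f : X → ℝ) =ᵐ[μ] E.indicator 1 → L f = (ℓ E).indicator 1)

theorem ae_norm_le_norm_of_top {X B : Type*} [MeasurableSpace X] [NormedAddCommGroup B]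
    {μ : Measure X} (v : Lp B ⊤ μ) : ∀ᵐ z ∂μ, ‖v z‖ ≤ ‖v‖ := by
  have htop := Lp.eLpNorm_ne_top v
  rw [Lp.norm_def]
  rw [eLpNorm_exponent_top] at htop ⊢
  filter_upwards [ae_le_eLpNormEssSup (f := v) (μ := μ)] with z hz
  simpa using ENNReal.toReal_mono htop hz

namespace IsVNLifting

variable {X : Type*} [MeasurableSpace X] {μ : Measure X} {ℓ : Set X → Set X}

theorem mono (hℓ : IsVNLifting μ ℓ) {E F : Set X} (hE : MeasurableSet E) (hF : MeasurableSet F)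
    (hEF : E ⊆ F) : ℓ E ⊆ ℓ F := by
  have h := hℓ.map_inter E F hE hF
  rw [inter_eq_left.2 hEF] at h
  exact h ▸ inter_subset_right

theorem notMem_of_disjoint (hℓ : IsVNLifting μ ℓ) {E F : Set X} (hE : MeasurableSet E)
    (hF : MeasurableSet F) (hEF : Disjoint E F) {x : X} (hx : x ∈ ℓ E) : x ∉ ℓ F := by
  intro hx'
  have h : x ∈ ℓ (E ∩ F) := by rw [hℓ.map_inter E F hE hF]; exact ⟨hx, hx'⟩
  rw [hEF.inter_eq, hℓ.map_empty] at h
  exact h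

theorem mem_compl_of_notMem (hℓ : IsVNLifting μ ℓ) {E : Set X} (hE : MeasurableSet E) {x : X}
    (hx : x ∉ ℓ E) : x ∈ ℓ Eᶜ := by
  have h : x ∈ ℓ (E ∪ Eᶜ) := by rw [union_compl_self, hℓ.map_univ]; trivial
  rw [hℓ.map_union E _ hE hE.compl] at h
  exact h.resolve_left hx

theorem eq_empty_of_measure_eq_zero (hℓ : IsVNLifting μ ℓ) {E : Set X} (hE : MeasurableSet E)
    (h : μ E = 0) : ℓ E = ∅ := by
  rw [hℓ.congr_ae E ∅ hE MeasurableSet.empty (by simpa using h), hℓ.map_empty]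

theorem nonempty_of_measure_pos (hℓ : IsVNLifting μ ℓ) {E : Set X} (hE : MeasurableSet E)
    (h : 0 < μ E) : (ℓ E).Nonempty := by
  by_contra hne
  have h0 := hℓ.ae_symmDiff E hE
  rw [not_nonempty_iff_eq_empty.1 hne] at h0
  simp only [symmDiff_def, sup_eq_union, sdiff_empty, empty_sdiff, union_empty] at h0
  exact h.ne' (by simpa using h0)

theorem exists_mem_of_mem_biUnion (hℓ : IsVNLifting μ ℓ) {ι : Type*} {t : Set ι} (ht : t.Finite)
    {A : ι → Set X} (hA : ∀ i, MeasurableSet (A i)) {x : X} (hx : x ∈ ℓ (⋃ i ∈ t, A i)) :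
    ∃ i, x ∈ ℓ (A i) := by
  induction t, ht using Set.Finite.induction_on with
  | empty => simp [hℓ.map_empty] at hx
  | @insert a s _ hs ih =>
    rw [biUnion_insert, hℓ.map_union _ _ (hA a)
      (MeasurableSet.biUnion hs.countable fun i _ => hA i)] at hx
    exact hx.elim (fun h => ⟨a, h⟩) ih

/-- An essentially bounded function with values in a proper space is almost constant near
every point, in the sense of the ultrafilter `{E | x ∈ ℓ E}`. -/
theorem exists_norm_sub_le (hℓ : IsVNLifting μ ℓ) {B : Type*} [NormedAddCommGroup B]
    [ProperSpace B] (v : Lp B ⊤ μ) (x : X) {ε : ℝ} (hε : 0 < ε) :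
    ∃ (E : Set X) (b : B), MeasurableSet E ∧ x ∈ ℓ E ∧ ∀ z ∈ E, ‖v z - b‖ ≤ ε := by
  obtain ⟨t, -, ht, hcov⟩ :=
    (isCompact_closedBall (0 : B) ‖v‖).finite_cover_balls hε
  have hA : ∀ b : B, MeasurableSet {z | ‖v z - b‖ < ε} := fun b =>
    measurableSet_lt ((Lp.stronglyMeasurable v).sub stronglyMeasurable_const).norm.measurable
      measurable_const
  have hU : MeasurableSet (⋃ b ∈ t, {z | ‖v z - b‖ < ε}) :=
    MeasurableSet.biUnion ht.countable fun b _ => hA b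
  have hx : x ∈ ℓ (⋃ b ∈ t, {z | ‖v z - b‖ < ε}) := by
    rw [hℓ.congr_ae _ univ hU MeasurableSet.univ, hℓ.map_univ]
    · trivial
    · rw [← top_eq_univ, symmDiff_top]
      refine mem_ae_iff.1 ?_
      filter_upwards [ae_norm_le_norm_of_top v] with z hz
      have := hcov (mem_closedBall_zero_iff.2 hz)
      simpa [dist_eq_norm] using this
  obtain ⟨b, hb⟩ := hℓ.exists_mem_of_mem_biUnion ht hA hx
  exact ⟨_, b, hA b, hb, fun z hz => le_of_lt hz⟩

/-- If every ultrafilter `{E | x ∈ ℓ E}` is countably complete, every set of positive measure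
contains an atom. -/
theorem exists_atom (hℓ : IsVNLifting μ ℓ) [SigmaFinite μ]
    (hcov : ∀ A : ℕ → Set X, (∀ n, MeasurableSet (A n)) → ⋃ n, A n = univ →
      ∀ x, ∃ n, x ∈ ℓ (A n))
    {E : Set X} (hE : MeasurableSet E) (hpos : 0 < μ E) :
    ∃ F ⊆ E, MeasurableSet F ∧ 0 < μ F ∧
      ∀ G, MeasurableSet G → G ⊆ F → μ G = 0 ∨ μ (F \ G) = 0 := by
  obtain ⟨E', hE', hE'E, hE'pos, hE'top⟩ := Measure.exists_subset_measure_lt_top hE hpos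
  obtain ⟨x, hx⟩ := hℓ.nonempty_of_measure_pos hE' hE'pos
  have hinter : ∀ F : ℕ → Set X, (∀ n, MeasurableSet (F n)) → (∀ n, x ∈ ℓ (F n)) →
      x ∈ ℓ (⋂ n, F n) := by
    intro F hF hxF
    obtain ⟨n, hn⟩ := hcov (fun n => Nat.casesOn n (⋂ n, F n) fun k => (F k)ᶜ)
      (by rintro (_ | n)
          · exact MeasurableSet.iInter hF
          · exact (hF n).compl)
      (by ext z
          simp only [mem_iUnion, mem_univ, iff_true]
          by_cases hz : z ∈ ⋂ n, F n
          · exact ⟨0, hz⟩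
          · obtain ⟨n, hn⟩ := not_forall.1 (mt mem_iInter.2 hz)
            exact ⟨n + 1, hn⟩) x
    rcases n with _ | n
    · exact hn
    · exact absurd (hxF n) (hℓ.notMem_of_disjoint (hF n).compl (hF n) disjoint_compl_left hn)
  let S : Set ENNReal := {r | ∃ F ⊆ E', MeasurableSet F ∧ x ∈ ℓ F ∧ μ F = r}
  have hS : S.Nonempty := ⟨_, E', Subset.rfl, hE', hx, rfl⟩
  obtain ⟨u, -, hu, huS⟩ := exists_seq_tendsto_sInf hS (OrderBot.bddBelow S)
  choose F hFE hF hxF hFu using huS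
  have hFm : MeasurableSet (⋂ n, F n) := MeasurableSet.iInter hF
  have hFE' : ⋂ n, F n ⊆ E' := (iInter_subset _ 0).trans (hFE 0)
  have hxm := hinter F hF hxF
  have hle : μ (⋂ n, F n) ≤ sInf S :=
    ge_of_tendsto' hu fun n => hFu n ▸ measure_mono (iInter_subset _ n)
  have htop : μ (⋂ n, F n) ≠ ⊤ := ((measure_mono hFE').trans_lt hE'top).ne
  refine ⟨_, hFE'.trans hE'E, hFm, ?_, fun G hG hGF => ?_⟩
  · refine pos_iff_ne_zero.2 fun h0 => ?_
    rw [hℓ.eq_empty_of_measure_eq_zero hFm h0] at hxm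
    exact hxm
  · have hadd := measure_inter_add_sdiff (μ := μ) (⋂ n, F n) hG
    rw [inter_eq_right.2 hGF] at hadd
    have hD : MeasurableSet ((⋂ n, F n) \ G) := hFm.diff hG
    have hGtop : μ G ≠ ⊤ := ((measure_mono hGF).trans_lt htop.lt_top).ne
    have hDtop : μ ((⋂ n, F n) \ G) ≠ ⊤ := ((measure_mono sdiff_subset).trans_lt htop.lt_top).ne
    have hxu : x ∈ ℓ (G ∪ (⋂ n, F n) \ G) := by rwa [union_sdiff_cancel hGF]
    rw [hℓ.map_union _ _ hG hD] at hxu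
    rcases hxu with h | h
    · right
      have h1 : μ G + μ ((⋂ n, F n) \ G) ≤ μ G + 0 := by
        rw [hadd, add_zero]
        exact hle.trans (sInf_le ⟨G, hGF.trans hFE', hG, h, rfl⟩)
      exact nonpos_iff_eq_zero.1 ((ENNReal.add_le_add_iff_left hGtop).1 h1)
    · left
      have h1 : μ G + μ ((⋂ n, F n) \ G) ≤ 0 + μ ((⋂ n, F n) \ G) := by
        rw [hadd, zero_add]
        exact hle.trans (sInf_le ⟨_, sdiff_subset.trans hFE', hD, h, rfl⟩)
      exact nonpos_iff_eq_zero.1 ((ENNReal.add_le_add_iff_right hDtop).1 h1)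

end IsVNLifting

namespace IsLinftyLifting

variable {X : Type*} [MeasurableSpace X] {μ : Measure X} {ℓ : Set X → Set X}
  {Lf : Lp ℝ ⊤ μ → X → ℝ}

theorem map_sub (hLf : IsLinftyLifting μ ℓ Lf) (f g : Lp ℝ ⊤ μ) : Lf (f - g) = Lf f - Lf g := by
  rw [eq_sub_iff_add_eq, ← hLf.1, sub_add_cancel]

/-- Positivity, localized at a point. -/
theorem nonneg (hLf : IsLinftyLifting μ ℓ Lf) {E : Set X} (hE : MeasurableSet E) {x : X}
    (hx : x ∈ ℓ E) {h : Lp ℝ ⊤ μ} (hh : ∀ᵐ z ∂μ, z ∈ E → 0 ≤ h z) : 0 ≤ Lf h x := by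
  have hmem : MemLp (E.indicator (1 : X → ℝ)) ⊤ μ := (memLp_top_const (1 : ℝ)).indicator hE
  have hI := hLf.2.2.2.2.2 E hE (hmem.toLp _) hmem.coeFn_toLp
  have hq : Lf (‖h‖ • hmem.toLp _ - h) x = ‖h‖ - Lf h x := by
    rw [hLf.map_sub, hLf.2.1, hI]
    simp [hx]
  have hnorm : ‖‖h‖ • hmem.toLp _ - h‖ ≤ ‖h‖ := by
    rw [Lp.norm_def, eLpNorm_exponent_top]
    refine ENNReal.toReal_le_of_le_ofReal (norm_nonneg h) (eLpNormEssSup_le_of_ae_bound ?_)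
    filter_upwards [Lp.coeFn_sub (‖h‖ • hmem.toLp _) h, Lp.coeFn_smul ‖h‖ (hmem.toLp _),
      hmem.coeFn_toLp, ae_norm_le_norm_of_top h, hh] with z h1 h2 h3 h4 h5
    rw [h1, Pi.sub_apply, h2, Pi.smul_apply, h3]
    rw [Real.norm_eq_abs, abs_le] at h4 ⊢
    by_cases hz : z ∈ E
    · have := h5 hz
      simp only [hz, indicator_of_mem, Pi.one_apply, smul_eq_mul, mul_one]
      constructor <;> linarith
    · simp only [hz, not_false_eq_true, indicator_of_notMem, smul_eq_mul, mul_zero]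
      constructor <;> linarith
  have := (le_abs_self _).trans ((hLf.2.2.2.1 _ x).trans hnorm)
  linarith

theorem mono (hLf : IsLinftyLifting μ ℓ Lf) {E : Set X} (hE : MeasurableSet E) {x : X}
    (hx : x ∈ ℓ E) {f g : Lp ℝ ⊤ μ} (h : ∀ᵐ z ∂μ, z ∈ E → f z ≤ g z) : Lf f x ≤ Lf g x := by
  rw [← sub_nonneg, ← Pi.sub_apply, ← hLf.map_sub]
  refine hLf.nonneg hE hx ?_
  filter_upwards [h, Lp.coeFn_sub g f] with z hz h1 hzE
  rw [h1, Pi.sub_apply]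
  exact sub_nonneg.2 (hz hzE)

theorem eq_const (hLf : IsLinftyLifting μ ℓ Lf) (hℓ : IsVNLifting μ ℓ) {c : ℝ} {f : Lp ℝ ⊤ μ}
    (hf : f =ᵐ[μ] fun _ => c) (x : X) : Lf f x = c := by
  have hmem : MemLp ((univ : Set X).indicator (1 : X → ℝ)) ⊤ μ :=
    (memLp_top_const (1 : ℝ)).indicator MeasurableSet.univ
  have hI := hLf.2.2.2.2.2 univ MeasurableSet.univ (hmem.toLp _) hmem.coeFn_toLp
  have hfc : f = c • hmem.toLp _ := by
    refine Lp.ext ?_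
    filter_upwards [hf, Lp.coeFn_smul c (hmem.toLp _), hmem.coeFn_toLp] with z h1 h2 h3
    rw [h1, h2, Pi.smul_apply, h3]
    simp
  rw [hfc, hLf.2.1, hI, hℓ.map_univ]
  simp

theorem le_of_le_on (hLf : IsLinftyLifting μ ℓ Lf) (hℓ : IsVNLifting μ ℓ) {E : Set X}
    (hE : MeasurableSet E) {x : X} (hx : x ∈ ℓ E) {f : Lp ℝ ⊤ μ} {c : ℝ}
    (h : ∀ᵐ z ∂μ, z ∈ E → f z ≤ c) : Lf f x ≤ c := by
  have hc := (memLp_top_const (μ := μ) c).coeFn_toLp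
  rw [← hLf.eq_const hℓ hc x]
  refine hLf.mono hE hx ?_
  filter_upwards [h, hc] with z h1 h2
  rwa [h2]

theorem ge_of_ge_on (hLf : IsLinftyLifting μ ℓ Lf) (hℓ : IsVNLifting μ ℓ) {E : Set X}
    (hE : MeasurableSet E) {x : X} (hx : x ∈ ℓ E) {f : Lp ℝ ⊤ μ} {c : ℝ}
    (h : ∀ᵐ z ∂μ, z ∈ E → c ≤ f z) : c ≤ Lf f x := by
  have hc := (memLp_top_const (μ := μ) c).coeFn_toLp
  rw [← hLf.eq_const hℓ hc x]
  refine hLf.mono hE hx ?_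
  filter_upwards [h, hc] with z h1 h2
  rwa [h2]

theorem abs_sub_le_of_abs_sub_le_on (hLf : IsLinftyLifting μ ℓ Lf) (hℓ : IsVNLifting μ ℓ)
    {E : Set X} (hE : MeasurableSet E) {x : X} (hx : x ∈ ℓ E) {f : Lp ℝ ⊤ μ} {c ε : ℝ}
    (h : ∀ᵐ z ∂μ, z ∈ E → |f z - c| ≤ ε) : |Lf f x - c| ≤ ε := by
  have h1 : Lf f x ≤ c + ε := hLf.le_of_le_on hℓ hE hx <| by
    filter_upwards [h] with z hz hzE
    linarith [(abs_le.1 (hz hzE)).2]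
  have h2 : c - ε ≤ Lf f x := hLf.ge_of_ge_on hℓ hE hx <| by
    filter_upwards [h] with z hz hzE
    linarith [(abs_le.1 (hz hzE)).1]
  exact abs_le.2 ⟨by linarith, by linarith⟩

theorem map_mul (hLf : IsLinftyLifting μ ℓ Lf) (hℓ : IsVNLifting μ ℓ) {f g h : Lp ℝ ⊤ μ}
    (hh : h =ᵐ[μ] fun z => f z * g z) (x : X) : Lf h x = Lf f x * Lf g x := by
  refine eq_of_forall_dist_le fun δ hδ => ?_
  rw [Real.dist_eq]
  obtain ⟨E, c, hE, hx, hc⟩ := hℓ.exists_norm_sub_le f x (ε := δ / (2 * ‖g‖ + 1)) (by positivity)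
  have h1 : |Lf f x - c| ≤ δ / (2 * ‖g‖ + 1) :=
    hLf.abs_sub_le_of_abs_sub_le_on hℓ hE hx (ae_of_all μ hc)
  have h2 : |Lf (h - c • g) x - 0| ≤ δ / (2 * ‖g‖ + 1) * ‖g‖ := by
    refine hLf.abs_sub_le_of_abs_sub_le_on hℓ hE hx ?_
    filter_upwards [hh, Lp.coeFn_sub h (c • g), Lp.coeFn_smul c g, ae_norm_le_norm_of_top g]
      with z h1 h2 h3 h4 hz
    rw [sub_zero, h2, Pi.sub_apply, h3, Pi.smul_apply, h1, smul_eq_mul, ← sub_mul, abs_mul]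
    exact mul_le_mul (hc z hz) h4 (abs_nonneg _) (by positivity)
  rw [sub_zero, hLf.map_sub, hLf.2.1, Pi.sub_apply, Pi.smul_apply, smul_eq_mul] at h2
  have h3 : |(Lf f x - c) * Lf g x| ≤ δ / (2 * ‖g‖ + 1) * ‖g‖ := by
    rw [abs_mul]
    exact mul_le_mul h1 (hLf.2.2.2.1 g x) (abs_nonneg _) (by positivity)
  have h4 : δ / (2 * ‖g‖ + 1) * (2 * ‖g‖ + 1) = δ := by field_simp
  have h5 : 0 < δ / (2 * ‖g‖ + 1) := by positivity
  calc |Lf h x - Lf f x * Lf g x|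
      = |(Lf h x - c * Lf g x) - (Lf f x - c) * Lf g x| := by ring_nf
    _ ≤ |Lf h x - c * Lf g x| + |(Lf f x - c) * Lf g x| := abs_sub _ _
    _ ≤ δ := by linarith

/-- A norm-preserving lifting with values in an infinite-dimensional space forces the
ultrafilters `{E | x ∈ ℓ E}` to be countably complete. -/
theorem exists_mem_of_iUnion_eq_univ {B : Type*} [NormedAddCommGroup B] [NormedSpace ℝ B]
    (hLf : IsLinftyLifting μ ℓ Lf) (hℓ : IsVNLifting μ ℓ) (hB : ¬ FiniteDimensional ℝ B)
    {T : Lp B ⊤ μ → X → B}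
    (hconst : ∀ (b : B) (v : Lp B ⊤ μ), v =ᵐ[μ] (fun _ => b) → ∀ x, T v x = b)
    (hadd : ∀ v w : Lp B ⊤ μ, ∀ x, T (v + w) x = T v x + T w x)
    (hnorm : ∀ (v : Lp B ⊤ μ) (g : Lp ℝ ⊤ μ), g =ᵐ[μ] (fun z => ‖v z‖) →
      ∀ x, ‖T v x‖ = Lf g x)
    {A : ℕ → Set X} (hA : ∀ n, MeasurableSet (A n)) (hU : ⋃ n, A n = univ) (x : X) :
    ∃ n, x ∈ ℓ (A n) := by
  classical
  obtain ⟨R, e, -, heR, hsep⟩ := exists_seq_norm_le_one_le_norm_sub (𝕜 := ℝ) (E := B) hB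
  have hex : ∀ z, ∃ n, z ∈ A n := fun z => mem_iUnion.1 (hU ▸ mem_univ z)
  let k : X → ℕ := fun z => Nat.find (hex z)
  have hk : Measurable k := measurable_find hex hA
  have hkA : ∀ n, k ⁻¹' {n} ⊆ A n := by
    rintro n z rfl
    exact Nat.find_spec (hex z)
  have hv : MemLp (fun z => e (k z)) ⊤ μ :=
    memLp_top_of_bound (StronglyMeasurable.of_discrete.comp_measurable hk).aestronglyMeasurable
      R (ae_of_all _ fun z => heR (k z))
  let v : Lp B ⊤ μ := hv.toLp _
  let y := T v x
  obtain ⟨m, hm⟩ : ∃ m, ∀ n, n ≠ m → 1 / 2 ≤ ‖e n - y‖ := by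
    by_cases h : ∃ m, ‖e m - y‖ < 1 / 2
    · obtain ⟨m, hm⟩ := h
      refine ⟨m, fun n hn => ?_⟩
      have h1 := hsep hn
      have h2 : ‖e n - e m‖ ≤ ‖e n - y‖ + ‖e m - y‖ := by
        simpa only [sub_sub_sub_cancel_right] using norm_sub_le (e n - y) (e m - y)
      linarith
    · push Not at h
      exact ⟨0, fun n _ => h n⟩
  have hkm : MeasurableSet (k ⁻¹' {m}) := hk (measurableSet_singleton m)
  refine ⟨m, hℓ.mono hkm (hA m) (hkA m) ?_⟩
  by_contra hxm
  let c : Lp B ⊤ μ := (memLp_top_const (μ := μ) (-y)).toLp _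
  have hc : c =ᵐ[μ] fun _ => -y := (memLp_top_const (μ := μ) (-y)).coeFn_toLp
  have hg := (Lp.memLp (v + c)).norm
  have h0 : Lf (hg.toLp _) x = 0 := by
    rw [← hnorm (v + c) _ hg.coeFn_toLp x, hadd, hconst _ c hc]
    simp [y]
  have h1 : (1 / 2 : ℝ) ≤ Lf (hg.toLp _) x := by
    refine hLf.ge_of_ge_on hℓ hkm.compl (hℓ.mem_compl_of_notMem hkm hxm) ?_
    filter_upwards [hg.coeFn_toLp, Lp.coeFn_add v c, hv.coeFn_toLp, hc] with z h1 h2 h3 h4 hz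
    rw [h1, h2, Pi.add_apply, h3, h4, ← sub_eq_add_neg]
    exact hm _ hz
  linarith

end IsLinftyLifting

section CoordinateLifting

variable {X B ι : Type*} [MeasurableSpace X] [NormedAddCommGroup B] [NormedSpace ℝ B]
  [FiniteDimensional ℝ B] [Fintype ι] {μ : Measure X} {ℓ : Set X → Set X}
  {Lf : Lp ℝ ⊤ μ → X → ℝ}

/-- The coordinate functionals of a basis, as continuous linear maps. -/
noncomputable def Module.Basis.continuousCoord (β : Module.Basis ι ℝ B) (i : ι) : B →L[ℝ] ℝ :=
  LinearMap.toContinuousLinearMap (β.coord i)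

theorem Module.Basis.sum_continuousCoord_smul (β : Module.Basis ι ℝ B) (b : B) :
    ∑ i, β.continuousCoord i b • β i = b := β.sum_repr b

/-- The coordinatewise lifting of functions with values in a finite-dimensional space. -/
noncomputable def coordinateLifting (Lf : Lp ℝ ⊤ μ → X → ℝ) (β : Module.Basis ι ℝ B)
    (v : Lp B ⊤ μ) (x : X) : B :=
  ∑ i, Lf ((β.continuousCoord i).compLp v) x • β i

theorem norm_coordinateLifting_sub_le (hLf : IsLinftyLifting μ ℓ Lf) (hℓ : IsVNLifting μ ℓ)
    (β : Module.Basis ι ℝ B) {E : Set X} (hE : MeasurableSet E) {x : X} (hx : x ∈ ℓ E)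
    {v : Lp B ⊤ μ} {b : B} {ε : ℝ} (h : ∀ᵐ z ∂μ, z ∈ E → ‖v z - b‖ ≤ ε) :
    ‖coordinateLifting Lf β v x - b‖ ≤ (∑ i, ‖β.continuousCoord i‖ * ‖β i‖) * ε := by
  have hb : coordinateLifting Lf β v x - b =
      ∑ i, (Lf ((β.continuousCoord i).compLp v) x - β.continuousCoord i b) • β i := by
    simp only [sub_smul, Finset.sum_sub_distrib, β.sum_continuousCoord_smul, coordinateLifting]
  rw [hb, Finset.sum_mul]
  refine (norm_sum_le _ _).trans (Finset.sum_le_sum fun i _ => ?_)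
  have hi : |Lf ((β.continuousCoord i).compLp v) x - β.continuousCoord i b| ≤
      ‖β.continuousCoord i‖ * ε := by
    refine hLf.abs_sub_le_of_abs_sub_le_on hℓ hE hx ?_
    filter_upwards [h, (β.continuousCoord i).coeFn_compLp v] with z h1 h2 hz
    rw [h2, ← _root_.map_sub, ← Real.norm_eq_abs]
    exact ((β.continuousCoord i).le_opNorm _).trans
      (mul_le_mul_of_nonneg_left (h1 hz) (norm_nonneg _))
  rw [norm_smul, Real.norm_eq_abs]
  calc _ ≤ ‖β.continuousCoord i‖ * ε * ‖β i‖ := mul_le_mul_of_nonneg_right hi (norm_nonneg _)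
    _ = _ := by ring

theorem stronglyMeasurable_coordinateLifting (hLf : IsLinftyLifting μ ℓ Lf)
    (β : Module.Basis ι ℝ B) (v : Lp B ⊤ μ) :
    StronglyMeasurable (coordinateLifting Lf β v) :=
  Finset.stronglyMeasurable_fun_sum _ fun i _ =>
    (hLf.2.2.1 _).stronglyMeasurable.smul_const (β i)

theorem norm_coordinateLifting_le (hLf : IsLinftyLifting μ ℓ Lf)
    (β : Module.Basis ι ℝ B) (v : Lp B ⊤ μ) (x : X) :
    ‖coordinateLifting Lf β v x‖ ≤ ∑ i, ‖(β.continuousCoord i).compLp v‖ * ‖β i‖ := by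
  refine (norm_sum_le _ _).trans (Finset.sum_le_sum fun i _ => ?_)
  rw [norm_smul]
  exact mul_le_mul_of_nonneg_right (hLf.2.2.2.1 _ x) (norm_nonneg _)

theorem coordinateLifting_ae_eq (hLf : IsLinftyLifting μ ℓ Lf)
    (β : Module.Basis ι ℝ B) (v : Lp B ⊤ μ) : coordinateLifting Lf β v =ᵐ[μ] v := by
  have h : ∀ᵐ z ∂μ, ∀ i, Lf ((β.continuousCoord i).compLp v) z = β.continuousCoord i (v z) :=
    ae_all_iff.2 fun i => (hLf.2.2.2.2.1 _).trans ((β.continuousCoord i).coeFn_compLp v)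
  filter_upwards [h] with z hz
  simp only [coordinateLifting, hz, β.sum_continuousCoord_smul]

theorem coordinateLifting_add (hLf : IsLinftyLifting μ ℓ Lf)
    (β : Module.Basis ι ℝ B) (v w : Lp B ⊤ μ) (x : X) :
    coordinateLifting Lf β (v + w) x =
      coordinateLifting Lf β v x + coordinateLifting Lf β w x := by
  simp only [coordinateLifting, ← Finset.sum_add_distrib,
    ← add_smul]
  refine Finset.sum_congr rfl fun i _ => ?_
  rw [← Pi.add_apply, ← hLf.1]
  exact congrArg (fun f => Lf f x • β i) (map_add ((β.continuousCoord i).compLpL ⊤ μ) v w)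

theorem coordinateLifting_eq_const (hLf : IsLinftyLifting μ ℓ Lf) (hℓ : IsVNLifting μ ℓ)
    (β : Module.Basis ι ℝ B) {b : B} {v : Lp B ⊤ μ} (hv : v =ᵐ[μ] fun _ => b) (x : X) :
    coordinateLifting Lf β v x = b := by
  have h := norm_coordinateLifting_sub_le hLf hℓ β MeasurableSet.univ
    (x := x) (v := v) (b := b) (ε := 0) (by rw [hℓ.map_univ]; trivial)
    (by filter_upwards [hv] with z hz _; simp [hz])
  rw [mul_zero] at h
  exact sub_eq_zero.1 (norm_le_zero_iff.1 h)

theorem norm_coordinateLifting (hLf : IsLinftyLifting μ ℓ Lf) (hℓ : IsVNLifting μ ℓ)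
    (β : Module.Basis ι ℝ B) {v : Lp B ⊤ μ} {g : Lp ℝ ⊤ μ} (hg : g =ᵐ[μ] fun z => ‖v z‖)
    (x : X) : ‖coordinateLifting Lf β v x‖ = Lf g x := by
  have : ProperSpace B := FiniteDimensional.proper ℝ B
  set K := ∑ i, ‖β.continuousCoord i‖ * ‖β i‖
  have hK : 0 ≤ K := Finset.sum_nonneg fun i _ => by positivity
  refine eq_of_forall_dist_le fun δ hδ => ?_
  rw [Real.dist_eq]
  obtain ⟨E, b, hE, hx, hb⟩ := hℓ.exists_norm_sub_le v x (ε := δ / (K + 1)) (by positivity)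
  have h1 := norm_coordinateLifting_sub_le hLf hℓ β hE hx (ae_of_all μ hb)
  have h2 : |Lf g x - ‖b‖| ≤ δ / (K + 1) := by
    refine hLf.abs_sub_le_of_abs_sub_le_on hℓ hE hx ?_
    filter_upwards [hg] with z hz hzE
    rw [hz]
    exact (abs_norm_sub_norm_le _ _).trans (hb z hzE)
  have h3 := abs_norm_sub_norm_le (coordinateLifting Lf β v x) b
  have h4 : K * (δ / (K + 1)) + δ / (K + 1) = δ := by field_simp
  have h5 := abs_sub_le ‖coordinateLifting Lf β v x‖ ‖b‖ (Lf g x)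
  rw [abs_sub_comm ‖b‖] at h5
  linarith

theorem coordinateLifting_smul (hLf : IsLinftyLifting μ ℓ Lf) (hℓ : IsVNLifting μ ℓ)
    (β : Module.Basis ι ℝ B) {f : Lp ℝ ⊤ μ} {v w : Lp B ⊤ μ}
    (hw : w =ᵐ[μ] fun z => f z • v z) (x : X) :
    coordinateLifting Lf β w x = Lf f x • coordinateLifting Lf β v x := by
  simp only [coordinateLifting, Finset.smul_sum, smul_smul]
  refine Finset.sum_congr rfl fun i _ => ?_
  rw [hLf.map_mul hℓ]
  filter_upwards [hw, (β.continuousCoord i).coeFn_compLp v,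
    (β.continuousCoord i).coeFn_compLp w] with z h1 h2 h3
  rw [h3, h2, h1, map_smul, smul_eq_mul]

end CoordinateLifting

/-- **Lifting of Lebesgue–Bochner spaces.** Over a complete σ-finite measure that is not
purely atomic, a norm-preserving lifting `L∞(μ; B) → ℒ∞(μ; B)` (compatible with the scalar
lifting and fixing constants) exists if and only if `B` is finite-dimensional. -/
theorem lifting_lebesgue_bochner_iff_finiteDimensional {X B : Type*} [MeasurableSpace X]
    [NormedAddCommGroup B] [NormedSpace ℝ B] [CompleteSpace B]
    (μ : Measure X) [SigmaFinite μ] (hc : μ.IsComplete)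
    (hNPA : ∃ E : Set X, MeasurableSet E ∧ 0 < μ E ∧
      ∀ A : Set X, ¬ IsMeasureAtom (μ.restrict E) A)
    (ℓ : Set X → Set X) (hℓ : IsVNLifting μ ℓ)
    (Lf : Lp ℝ ⊤ μ → X → ℝ) (hLf : IsLinftyLifting μ ℓ Lf) :
    (∃ T : Lp B ⊤ μ → X → B,
      -- `T` takes values in `ℒ∞(μ; B)`
      (∀ v : Lp B ⊤ μ, StronglyMeasurable (T v) ∧ ∃ C : ℝ, ∀ x, ‖T v x‖ ≤ C) ∧
      -- constants are fixed
      (∀ (b : B) (v : Lp B ⊤ μ), ((v : X → B) =ᵐ[μ] fun _ => b) → ∀ x, T v x = b) ∧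
      -- `T v` represents `v`
      (∀ v : Lp B ⊤ μ, T v =ᵐ[μ] v) ∧
      -- pointwise additivity
      (∀ v w : Lp B ⊤ μ, ∀ x, T (v + w) x = T v x + T w x) ∧
      -- compatibility with multiplication by `L∞(μ)`-functions
      (∀ (f : Lp ℝ ⊤ μ) (v w : Lp B ⊤ μ),
        ((w : X → B) =ᵐ[μ] fun z => (f : X → ℝ) z • (v : X → B) z) →
        ∀ x, T w x = Lf f x • T v x) ∧
      -- the pointwise norm is preserved
      (∀ (v : Lp B ⊤ μ) (g : Lp ℝ ⊤ μ),
        ((g : X → ℝ) =ᵐ[μ] fun z => ‖(v : X → B) z‖) → ∀ x, ‖T v x‖ = Lf g x)) ↔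
    FiniteDimensional ℝ B := by
  obtain ⟨E, hE, hEpos, hatom⟩ := hNPA
  constructor
  · rintro ⟨T, -, hconst, -, hadd, -, hnorm⟩
    by_contra hB
    obtain ⟨F, hFE, hF, hFpos, hsplit⟩ := hℓ.exists_atom
      (fun A hA hU x => hLf.exists_mem_of_iUnion_eq_univ hℓ hB hconst hadd hnorm hA hU x) hE hEpos
    refine hatom F ⟨hF, ?_, fun G hG hGF => ?_⟩
    · rwa [Measure.restrict_eq_self _ hFE]
    · rw [Measure.restrict_eq_self _ (hGF.trans hFE),
        Measure.restrict_eq_self _ (sdiff_subset.trans hFE)]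
      exact hsplit G hG hGF
  · intro hB
    let β := Module.finBasis ℝ B
    exact ⟨coordinateLifting Lf β,
      fun v => ⟨stronglyMeasurable_coordinateLifting hLf β v, _,
        norm_coordinateLifting_le hLf β v⟩,
      fun b v hv => coordinateLifting_eq_const hLf hℓ β hv,
      coordinateLifting_ae_eq hLf β, coordinateLifting_add hLf β,
      fun f v w hw => coordinateLifting_smul hLf hℓ β hw,
      fun v g hg => norm_coordinateLifting hLf hℓ β hg⟩
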